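/- arXiv:1311.6907 — 4 statements merged into one kernel-verified Lean document; each statement's English description precedes it below -/
import Mathlib

section
/- Let s = ⟨a_1,…,a_n⟩ be a sequence over an alphabet Σ, let EOS ∉ Σ, let A_s be the subsequence automaton of s, let ℓ be an integer with ℓ ≥ n, and let p be a sequence over Σ (containing no EOS) with length |p| ≤ ℓ. Then the word p · EOS^{ℓ−|p|} (p followed by ℓ−|p| copies of EOS) is accepted by A_s if and only if p is a subsequence of s. -/
/-- The padded word `p · EOS^(ℓ - |p|)` over `Σ ∪ {EOS}`, with `EOS` modelled as `none`. -/
def padded {α : Type*} (p : List α) (ℓ : ℕ) : List (Option α) :=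
  p.map some ++ List.replicate (ℓ - p.length) none

/-- The subsequence automaton `A_s` of a sequence `s = ⟨a_1,…,a_n⟩`: states `{0,…,n}`,
initial state `0`, unique accepting state `n`, a transition from `q` to `j` labeled `a_j`
for all `0 ≤ q < j ≤ n`, and a transition from every state `q` to `n` labeled `EOS`. -/
def subseqNFA {α : Type*} (s : List α) : NFA (Option α) (Fin (s.length + 1)) where
  step q a :=
    match a with
    | none => {Fin.last s.length}
    | some x => { j | ∃ h : (q : ℕ) < (j : ℕ),
        s[(j : ℕ) - 1]'(by have := j.isLt; omega) = x }
  start := {0}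
  accept := {Fin.last s.length}

theorem List.cons_sublist_drop_iff {α : Type*} {s p : List α} {x : α} {q : ℕ} :
    (x :: p).Sublist (s.drop q) ↔
      ∃ i, ∃ h : i < s.length, q ≤ i ∧ s[i] = x ∧ p.Sublist (s.drop (i + 1)) := by
  constructor
  · rw [List.cons_sublist_iff]
    rintro ⟨r₁, r₂, hr, hx, hp⟩
    obtain ⟨k, hk, rfl⟩ := List.getElem_of_mem hx
    have hlen := congrArg List.length hr
    simp only [List.length_drop, List.length_append] at hlen
    refine ⟨q + k, by omega, by omega, ?_, ?_⟩
    · rw [← List.getElem_drop (h := by simp; omega)]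
      simp [hr, hk]
    · have hdrop : s.drop (q + k + 1) = (r₁ ++ r₂).drop (k + 1) := by
        rw [← hr, List.drop_drop, Nat.add_assoc]
      rw [hdrop, List.drop_append_of_le_length (by omega)]
      exact hp.trans (List.sublist_append_right _ _)
  · rintro ⟨i, hi, hqi, rfl, hp⟩
    refine List.Sublist.trans ?_ (List.drop_sublist_drop_left s hqi)
    rw [List.drop_eq_getElem_cons hi]
    exact hp.cons_cons _

theorem mem_subseqNFA_step_some {α : Type*} {s : List α} {q j : Fin (s.length + 1)} {x : α} :
    j ∈ (subseqNFA s).step q (some x) ↔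
      ∃ _ : (q : ℕ) < (j : ℕ), s[(j : ℕ) - 1]'(by have := j.isLt; omega) = x :=
  Iff.rfl

theorem subseqNFA_evalFrom_last_replicate_none {α : Type*} (s : List α) (k : ℕ) :
    (subseqNFA s).evalFrom {Fin.last s.length} (List.replicate k none) =
      {Fin.last s.length} := by
  induction k with
  | zero => rfl
  | succ k ih =>
    rw [List.replicate_succ, NFA.evalFrom_cons, NFA.stepSet_singleton]
    exact ih

/-- From state `q`, a padded word long enough to reach the last state is accepted iff the
unpadded sequence is a subsequence of the suffix starting after position `q`. -/
theorem last_mem_subseqNFA_evalFrom_iff {α : Type*} (s p : List α) (k : ℕ)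
    (q : Fin (s.length + 1)) (h : s.length ≤ q + p.length + k) :
    Fin.last s.length ∈
        (subseqNFA s).evalFrom {q} (p.map some ++ List.replicate k none) ↔
      p.Sublist (s.drop q) := by
  induction p generalizing q with
  | nil =>
    simp only [List.map_nil, List.nil_append, List.nil_sublist, iff_true]
    cases k with
    | zero =>
      have hq : q = Fin.last s.length := Fin.ext (by
        have := q.isLt
        simp at h ⊢
        omega)
      simp [hq]
    | succ k =>
      rw [List.replicate_succ, NFA.evalFrom_cons, NFA.stepSet_singleton]
      exact (subseqNFA_evalFrom_last_replicate_none s k).symm ▸ Set.mem_singleton _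
  | cons x p ih =>
    rw [List.map_cons, List.cons_append, NFA.evalFrom_cons, NFA.stepSet_singleton,
      NFA.mem_evalFrom_iff_exists, List.cons_sublist_drop_iff]
    simp only [List.length_cons] at h
    constructor
    · rintro ⟨j, hj, hp⟩
      obtain ⟨hqj, hx⟩ := mem_subseqNFA_step_some.1 hj
      rw [ih j (by omega)] at hp
      have := j.isLt
      refine ⟨j - 1, by omega, by omega, hx, ?_⟩
      rwa [Nat.sub_add_cancel (by omega)]
    · rintro ⟨i, hi, hqi, hx, hp⟩
      refine ⟨⟨i + 1, by omega⟩, mem_subseqNFA_step_some.2 ⟨Nat.lt_succ_of_le hqi, hx⟩, ?_⟩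
      rw [ih _ (by simp only; omega)]
      exact hp

/-- The padded word `p · EOS^(ℓ-|p|)` is accepted by the subsequence automaton `A_s`
iff `p` is a subsequence of `s`. -/
theorem stmt0 {α : Type*} (s p : List α) (ℓ : ℕ)
    (hs : s.length ≤ ℓ) (hp : p.length ≤ ℓ) :
    padded p ℓ ∈ (subseqNFA s).accepts ↔ p.Sublist s := by
  have h := last_mem_subseqNFA_evalFrom_iff s p (ℓ - p.length) 0
    (by simp only [Fin.val_zero]; omega)
  rw [Fin.val_zero, List.drop_zero] at h
  rw [← h, NFA.mem_accepts]
  simp [subseqNFA, padded]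
end

section
/- Let s = ⟨a_1,…,a_n⟩ be a sequence over an alphabet Σ, EOS ∉ Σ, and A_s the subsequence automaton of s. If a word of the form p · EOS^k, where p is a word over Σ containing no EOS and k ≥ 0, is accepted by A_s, then p is a subsequence of s. -/
/-- A word `p` over `Σ` leading from the initial state to `j` is a subsequence of the prefix of
`s` of length `j`. -/
theorem sublist_take_of_mem_eval_subseqNFA {α : Type*} (s p : List α) (j : Fin (s.length + 1))
    (h : j ∈ (subseqNFA s).eval (p.map some)) : p.Sublist (s.take j) := by
  induction p using List.reverseRecOn generalizing j with
  | nil => exact List.nil_sublist _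
  | append_singleton p x ih =>
    rw [List.map_append, List.map_singleton, NFA.eval_append_singleton, NFA.mem_stepSet] at h
    obtain ⟨q, hq, hlt, hx⟩ := h
    have hj : (j : ℕ) - 1 < s.length := by omega
    have htake : s.take j = s.take ((j : ℕ) - 1) ++ [x] := by
      rw [← hx, List.take_append_getElem hj]
      congr 1
      omega
    rw [htake]
    exact ((ih q hq).trans (List.take_sublist_take_left (by omega))).append (List.Sublist.refl _)

/-- If a word of the form `p · EOS^k` (with `p` over `Σ`, containing no `EOS`) is accepted
by the subsequence automaton `A_s`, then `p` is a subsequence of `s`. -/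
theorem stmt2 {α : Type*} (s p : List α) (k : ℕ)
    (h : (p.map some ++ List.replicate k (none : Option α)) ∈ (subseqNFA s).accepts) :
    p.Sublist s := by
  obtain ⟨j, -, hj⟩ := NFA.mem_accepts.1 h
  rw [NFA.evalFrom_append, NFA.mem_evalFrom_iff_exists] at hj
  obtain ⟨q, hq, -⟩ := hj
  exact (sublist_take_of_mem_eval_subseqNFA s p q hq).trans (List.take_sublist _ _)
end

section
/- Let s = ⟨a_1,…,a_n⟩ be a sequence over an alphabet Σ, EOS ∉ Σ, M ≤ N natural numbers, A_s^{[M,N]} the gap-constrained subsequence automaton of s, ℓ ≥ n, and p = ⟨p_1,…,p_m⟩ a sequence over Σ with m ≤ ℓ. Then the word p · EOS^{ℓ−m} is accepted by A_s^{[M,N]} if and only if p occurs in s with gap constraint [M,N], i.e. there exist indices 1 ≤ j_1 < j_2 < … < j_m ≤ n with a_{j_k} = p_k for all k and M ≤ j_{k+1} − j_k − 1 ≤ N for all 1 ≤ k < m. -/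
/-- The gap-constrained subsequence automaton `A_s^{[M,N]}` of `s = ⟨a_1,…,a_n⟩`:
states `{0,…,n}`, initial state `0`, unique accepting state `n`, a transition from `q` to `j`
labeled `a_j` for all `0 ≤ q < j ≤ n` such that `q = 0` or `M ≤ j - q - 1 ≤ N`, and a
transition from every state `q` to `n` labeled `EOS` (modelled as `none`). -/
def gapNFA {α : Type*} (s : List α) (M N : ℕ) : NFA (Option α) (Fin (s.length + 1)) where
  step q a :=
    match a with
    | none => {Fin.last s.length}
    | some x => { j | ∃ h : (q : ℕ) < (j : ℕ),
        s[(j : ℕ) - 1]'(by have := j.isLt; omega) = x ∧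
        ((q : ℕ) = 0 ∨ (M ≤ (j : ℕ) - (q : ℕ) - 1 ∧ (j : ℕ) - (q : ℕ) - 1 ≤ N)) }
  start := {0}
  accept := {Fin.last s.length}

/-- `p` occurs in `s` with gap constraint `[M,N]`: there are strictly increasing matching
positions such that between every two neighbor matched positions at least `M` and at most `N`
items of `s` are skipped. -/
def OccursWithGap {α : Type*} (p s : List α) (M N : ℕ) : Prop :=
  ∃ f : Fin p.length → Fin s.length, StrictMono f ∧
    (∀ k, s.get (f k) = p.get k) ∧
    (∀ (k : ℕ) (h : k + 1 < p.length),
      M ≤ (f ⟨k + 1, h⟩ : ℕ) - (f ⟨k, by omega⟩ : ℕ) - 1 ∧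
      (f ⟨k + 1, h⟩ : ℕ) - (f ⟨k, by omega⟩ : ℕ) - 1 ≤ N)

/-- A state is reachable along a word iff there is a sequence of states, starting in the given set
and ending in that state, whose consecutive members are linked by transitions spelling the word. -/
theorem NFA.mem_evalFrom_iff_exists_seq {β σ : Type*} (A : NFA β σ) (S : Set σ) (x : List β)
    (j : σ) :
    j ∈ A.evalFrom S x ↔ ∃ g : ℕ → σ, g 0 ∈ S ∧ g x.length = j ∧
      ∀ (k : ℕ) (h : k < x.length), g (k + 1) ∈ A.step (g k) x[k] := by
  induction x using List.reverseRecOn generalizing j with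
  | nil =>
    simp only [NFA.evalFrom_nil, List.length_nil, not_lt_zero, IsEmpty.forall_iff, implies_true,
      and_true]
    exact ⟨fun h => ⟨fun _ => j, h, rfl⟩, fun ⟨g, h, e⟩ => e ▸ h⟩
  | append_singleton x a ih =>
    rw [NFA.evalFrom_append, NFA.evalFrom_singleton, NFA.mem_stepSet]
    constructor
    · rintro ⟨t, ht, hj⟩
      obtain ⟨g, h0, hl, hg⟩ := (ih t).1 ht
      refine ⟨fun k => if k ≤ x.length then g k else j, by simpa using h0, by simp, ?_⟩
      intro k hk
      rw [List.length_append, List.length_singleton] at hk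
      by_cases hkx : k < x.length
      · have h1 : k + 1 ≤ x.length := hkx
        simpa [h1, hkx.le, List.getElem_append_left hkx] using hg k hkx
      · obtain rfl : k = x.length := by omega
        simpa [hl] using hj
    · rintro ⟨g, h0, hl, hg⟩
      refine ⟨g x.length, (ih _).2 ⟨g, h0, rfl, fun k hk => ?_⟩, ?_⟩
      · have h := hg k (by simp; omega)
        rwa [List.getElem_append_left hk] at h
      · simpa [← hl] using hg x.length (by simp)

/-- Reading `EOS^r` leads from a set `S` of states to the accepting state iff `S` is nonempty and,
when `r = 0`, already contains the accepting state. -/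
theorem gapNFA_last_mem_evalFrom_replicate {α : Type*} (s : List α) (M N r : ℕ)
    (S : Set (Fin (s.length + 1))) :
    Fin.last s.length ∈ (gapNFA s M N).evalFrom S (List.replicate r none) ↔
      ∃ j ∈ S, j = Fin.last s.length ∨ 0 < r := by
  cases r with
  | zero => simp
  | succ r =>
    induction r generalizing S with
    | zero => simp [NFA.mem_stepSet, gapNFA]
    | succ r ih =>
      rw [List.replicate_succ, NFA.evalFrom_cons, ih]
      simp [NFA.mem_stepSet, gapNFA]

theorem padded_mem_accepts_gapNFA_iff {α : Type*} (s p : List α) (M N ℓ : ℕ) :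
    padded p ℓ ∈ (gapNFA s M N).accepts ↔
      ∃ j ∈ (gapNFA s M N).eval (p.map some), j = Fin.last s.length ∨ p.length < ℓ := by
  have h := gapNFA_last_mem_evalFrom_replicate s M N (ℓ - p.length)
    ((gapNFA s M N).eval (p.map some))
  rw [tsub_pos_iff_lt] at h
  rw [← h, NFA.mem_accepts, padded, NFA.evalFrom_append]
  simp [gapNFA, NFA.eval]

/-- The padded word `p · EOS^(ℓ-|p|)` is accepted by the gap-constrained subsequence
automaton `A_s^{[M,N]}` iff `p` occurs in `s` with gap constraint `[M,N]`. -/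
theorem stmt4 {α : Type*} (s p : List α) (M N ℓ : ℕ) (hMN : M ≤ N)
    (hs : s.length ≤ ℓ) (hp : p.length ≤ ℓ) :
    padded p ℓ ∈ (gapNFA s M N).accepts ↔ OccursWithGap p s M N := by
  rw [padded_mem_accepts_gapNFA_iff]
  constructor
  · rintro ⟨j, hj, -⟩
    obtain ⟨g, h0, -, hg⟩ := (NFA.mem_evalFrom_iff_exists_seq _ _ _ _).1 hj
    have hstep : ∀ k (hk : k < p.length), ∃ h : (g k : ℕ) < (g (k + 1) : ℕ),
        s[(g (k + 1) : ℕ) - 1]'(by have := (g (k + 1)).isLt; omega) = p[k] ∧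
        ((g k : ℕ) = 0 ∨ (M ≤ (g (k + 1) : ℕ) - (g k : ℕ) - 1 ∧
          (g (k + 1) : ℕ) - (g k : ℕ) - 1 ≤ N)) := by
      intro k hk
      have h := hg k (by simpa using hk)
      rw [List.getElem_map] at h
      exact h
    refine ⟨fun k => ⟨(g (k + 1) : ℕ) - 1, ?_⟩, ?_, ?_, ?_⟩
    · obtain ⟨h, -⟩ := hstep k k.isLt
      have := (g (k + 1)).isLt
      omega
    · have hmono : ∀ b, b < p.length → ∀ a < b, (g (a + 1) : ℕ) < (g (b + 1) : ℕ) := by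
        intro b
        induction b with
        | zero => intro _ a ha; omega
        | succ b ih =>
          intro hb a ha
          obtain ⟨h, -⟩ := hstep (b + 1) hb
          rcases Nat.lt_succ_iff_lt_or_eq.1 ha with hab | rfl
          · exact (ih (by omega) a hab).trans h
          · exact h
      intro a b hab
      have hb := hmono b b.isLt a hab
      obtain ⟨ha, -⟩ := hstep a a.isLt
      simp only [Fin.mk_lt_mk]
      omega
    · intro k
      obtain ⟨_, h, _⟩ := hstep k k.isLt
      simpa using h
    · intro k hk
      obtain ⟨h1, -⟩ := hstep k (by omega)
      obtain ⟨h2, -, h3⟩ := hstep (k + 1) hk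
      simp only
      omega
  · rintro ⟨f, hf, hget, hgap⟩
    let g : ℕ → Fin (s.length + 1) := fun k =>
      if h : 0 < k ∧ k ≤ p.length then (f ⟨k - 1, by omega⟩).succ else 0
    have hg0 : g 0 = 0 := by simp [g]
    have hgs : ∀ k (hk : k < p.length), g (k + 1) = (f ⟨k, hk⟩).succ := by
      intro k hk
      simp [g, hk]
    have hlt : ∀ k, k < p.length → (g k : ℕ) < (g (k + 1) : ℕ) := by
      intro k hk
      rw [hgs k hk]
      cases k with
      | zero => simp [hg0]
      | succ k =>
        rw [hgs k (by omega)]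
        have h := @hf ⟨k, by omega⟩ ⟨k + 1, hk⟩ (by simp)
        simpa using h
    have hle : ∀ k, k ≤ p.length → k ≤ (g k : ℕ) := by
      intro k
      induction k with
      | zero => simp
      | succ k ih =>
        intro hk
        have := ih (by omega)
        have := hlt k hk
        omega
    refine ⟨g p.length, (NFA.mem_evalFrom_iff_exists_seq _ _ _ _).2
      ⟨g, hg0, by simp, fun k hk => ?_⟩, ?_⟩
    · have hk : k < p.length := by simpa using hk
      have h := hlt k hk
      rw [List.getElem_map]
      refine ⟨h, ?_, ?_⟩
      · simpa [hgs k hk] using hget ⟨k, hk⟩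
      · cases k with
        | zero => simp [hg0]
        | succ k =>
          right
          have := hgap k hk
          rw [hgs _ hk, hgs k (by omega)]
          simp only [Fin.val_succ]
          omega
    · have h1 := hle p.length le_rfl
      have h2 := (g p.length).isLt
      rw [Fin.ext_iff, Fin.val_last]
      omega
end

section
/- (Frequent Sequential Pattern Mining with Gap, Theorem 2.) Let SDB be a sequence database over an alphabet Σ, ℓ the maximal length of a sequence in SDB, minsup a natural number, M ≤ N natural numbers, and p a sequence over Σ with |p| ≤ ℓ. Then the number of sequences s ∈ SDB in which p occurs with gap constraint [M,N] is at least minsup if and only if the number of sequences s ∈ SDB such that the word p · EOS^{ℓ−|p|} is accepted by the gap-constrained subsequence automaton A_s^{[M,N]} is at least minsup. -/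
open Classical in
/-- Number of sequences of the database `SDB` satisfying the property `P`. -/
noncomputable def countSat {α : Type*} (SDB : List (List α)) (P : List α → Prop) : ℕ :=
  SDB.countP fun s => decide (P s)

/-- The support `sup(p)` of `p`: the number of sequences of `SDB` containing `p`
as a subsequence. -/
noncomputable def support {α : Type*} (SDB : List (List α)) (p : List α) : ℕ :=
  countSat SDB fun s => p.Sublist s

/-- A state is reached on the letters of `p` iff it is the end of a run `g` of the automaton. -/
theorem mem_evalFrom_map_some_iff {α : Type*} (s : List α) (M N : ℕ)
    (q : Fin (s.length + 1)) (p : List α) (j : Fin (s.length + 1)) :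
    j ∈ (gapNFA s M N).evalFrom {q} (p.map some) ↔
      ∃ g : ℕ → ℕ, g 0 = q ∧ g p.length = j ∧ ∀ (k : ℕ) (_ : k < p.length),
        g k < g (k + 1) ∧ s[g (k + 1) - 1]? = some p[k] ∧
        (g k = 0 ∨ (M ≤ g (k + 1) - g k - 1 ∧ g (k + 1) - g k - 1 ≤ N)) := by
  induction p using List.reverseRecOn generalizing j with
  | nil =>
    simp only [List.map_nil, NFA.evalFrom_nil, Set.mem_singleton_iff, List.length_nil]
    constructor
    · rintro rfl
      exact ⟨fun _ => j, rfl, rfl, by simp⟩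
    · rintro ⟨g, h0, h1, -⟩
      exact Fin.ext (h1.symm.trans h0)
  | append_singleton p x ih =>
    rw [List.map_append, List.map_singleton, NFA.evalFrom_append, NFA.evalFrom_singleton,
      NFA.mem_stepSet]
    constructor
    · rintro ⟨i, hi, hlt, hx, hgap⟩
      obtain ⟨g, h0, h1, hg⟩ := (ih i).1 hi
      refine ⟨fun k => if k ≤ p.length then g k else j, by simpa using h0, by simp, ?_⟩
      intro k hk
      simp only [List.length_append, List.length_singleton] at hk
      rcases Nat.lt_succ_iff_lt_or_eq.1 hk with hk' | rfl
      · simpa [hk'.le, Nat.succ_le_of_lt hk', List.getElem_append_left hk'] using hg k hk'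
      · simp only [le_refl, if_true, h1, add_le_iff_nonpos_right, nonpos_iff_eq_zero,
          one_ne_zero, if_false]
        refine ⟨hlt, ?_, hgap⟩
        rw [List.getElem?_eq_getElem (by have := j.isLt; omega), hx]
        simp
    · rintro ⟨g, h0, h1, hg⟩
      simp only [List.length_append, List.length_singleton] at h1 hg
      obtain ⟨hlt, hx, hgap⟩ := hg p.length (by omega)
      have hj := j.isLt
      refine ⟨⟨g p.length, by omega⟩, (ih _).2 ⟨g, h0, rfl, ?_⟩, ?_⟩
      · intro k hk
        simpa [List.getElem_append_left hk] using hg k (by omega)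
      · rw [h1] at hlt hx hgap
        refine ⟨hlt, ?_, hgap⟩
        rw [List.getElem?_eq_getElem (by omega)] at hx
        simpa using hx

/-- After at least one `EOS`, the automaton is in the accepting state iff it was in any state. -/
theorem last_mem_evalFrom_replicate_none {α : Type*} (s : List α) (M N n : ℕ)
    (S : Set (Fin (s.length + 1))) :
    Fin.last s.length ∈ (gapNFA s M N).evalFrom S (List.replicate (n + 1) none) ↔
      S.Nonempty := by
  induction n generalizing S with
  | zero =>
    simp [NFA.mem_stepSet, gapNFA, Set.Nonempty]
  | succ n ih =>
    rw [List.replicate_succ, NFA.evalFrom_cons, ih]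
    simp [Set.Nonempty, NFA.mem_stepSet, gapNFA]

/-- The pattern occurs iff the automaton has a run on its letters. -/
theorem occursWithGap_iff_evalFrom_nonempty {α : Type*} (p s : List α) (M N : ℕ) :
    OccursWithGap p s M N ↔ ((gapNFA s M N).evalFrom {0} (p.map some)).Nonempty := by
  simp only [Set.Nonempty, mem_evalFrom_map_some_iff]
  constructor
  · rintro ⟨f, hmono, hget, hgap⟩
    let g : ℕ → ℕ := fun k => if h : k - 1 < p.length ∧ k ≠ 0 then f ⟨k - 1, h.1⟩ + 1 else 0
    have hsucc : ∀ (k : ℕ) (hk : k < p.length), g (k + 1) = f ⟨k, hk⟩ + 1 := by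
      intro k hk
      simp [g, hk]
    have hlt : g p.length < s.length + 1 := by
      simp only [g]
      split_ifs with h
      · have := (f ⟨p.length - 1, h.1⟩).isLt
        omega
      · omega
    refine ⟨⟨g p.length, hlt⟩, g, by simp [g], rfl, ?_⟩
    intro k hk
    have hx : s[g (k + 1) - 1]? = some p[k] := by
      simpa [hsucc k hk] using hget ⟨k, hk⟩
    rcases k with - | k
    · exact ⟨by simp [hsucc 0 hk, g], hx, Or.inl (by simp [g])⟩
    · have hm : f ⟨k, by omega⟩ < f ⟨k + 1, hk⟩ := hmono (by simp [Fin.lt_def])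
      have hgk := hgap k hk
      rw [Fin.lt_def] at hm
      rw [hsucc (k + 1) hk] at hx ⊢
      rw [hsucc k (by omega)]
      exact ⟨by omega, hx, Or.inr (by omega)⟩
  · rintro ⟨j, g, -, -, hg⟩
    have hbound : ∀ k (hk : k < p.length), g (k + 1) - 1 < s.length := fun k hk =>
      (List.getElem?_eq_some_iff.1 (hg k hk).2.1).1
    refine ⟨fun k => ⟨g (k + 1) - 1, hbound k k.isLt⟩, ?_, ?_, ?_⟩
    · have hmono : ∀ b, b < p.length → ∀ a < b, g (a + 1) < g (b + 1) := by
        intro b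
        induction b with
        | zero => omega
        | succ b ih =>
          intro hb a ha
          have hstep := (hg (b + 1) hb).1
          rcases Nat.lt_succ_iff_lt_or_eq.1 ha with h | rfl
          · exact (ih (by omega) a h).trans hstep
          · exact hstep
      intro a b hab
      have h1 := hmono b b.isLt a hab
      have h2 := (hg a a.isLt).1
      simp only [Fin.lt_def]
      omega
    · intro k
      exact (List.getElem?_eq_some_iff.1 (hg k k.isLt).2.1).2
    · intro k hk
      have h1 := (hg k (by omega)).1
      have h2 := hg (k + 1) hk
      simp only
      omega

/-- A word of `s.length` or more letters can only lead to the accepting state. -/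
theorem eq_last_of_mem_evalFrom {α : Type*} (p s : List α) (M N : ℕ)
    (hlen : s.length ≤ p.length) {j : Fin (s.length + 1)}
    (hj : j ∈ (gapNFA s M N).evalFrom {0} (p.map some)) : j = Fin.last s.length := by
  obtain ⟨g, -, h1, hg⟩ := (mem_evalFrom_map_some_iff s M N 0 p j).1 hj
  have hle : ∀ k ≤ p.length, k ≤ g k := by
    intro k
    induction k with
    | zero => omega
    | succ k ih =>
      intro hk
      have := ih (by omega)
      have := (hg k hk).1
      omega
  have := hle p.length le_rfl
  have := j.isLt
  apply Fin.ext
  simp only [Fin.val_last]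
  omega

theorem padded_mem_accepts_iff {α : Type*} (p s : List α) (M N ℓ : ℕ)
    (hs : s.length ≤ ℓ) (hp : p.length ≤ ℓ) :
    padded p ℓ ∈ (gapNFA s M N).accepts ↔ OccursWithGap p s M N := by
  have hacc : padded p ℓ ∈ (gapNFA s M N).accepts ↔
      Fin.last s.length ∈ (gapNFA s M N).evalFrom {0} (padded p ℓ) := by
    rw [NFA.mem_accepts]
    simp [gapNFA]
  rw [hacc, padded, NFA.evalFrom_append, occursWithGap_iff_evalFrom_nonempty]
  rcases hn : ℓ - p.length with - | n
  · rw [List.replicate_zero, NFA.evalFrom_nil]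
    refine ⟨fun h => ⟨_, h⟩, ?_⟩
    rintro ⟨j, hj⟩
    rwa [← eq_last_of_mem_evalFrom p s M N (by omega) hj]
  · exact last_mem_evalFrom_replicate_none s M N n _

/-- Frequent Sequential Pattern Mining with Gap (Theorem 2): the number of sequences of
`SDB` in which `p` occurs with gap constraint `[M,N]` is at least `minsup` iff the number
of sequences `s ∈ SDB` whose automaton `A_s^{[M,N]}` accepts the padded word
`p · EOS^(ℓ-|p|)` is at least `minsup`. -/
theorem stmt5 {α : Type*} (SDB : List (List α)) (ℓ minsup M N : ℕ) (hMN : M ≤ N)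
    (p : List α) (hℓ : ∀ s ∈ SDB, s.length ≤ ℓ) (hp : p.length ≤ ℓ) :
    minsup ≤ countSat SDB (fun s => OccursWithGap p s M N) ↔
      minsup ≤ countSat SDB (fun s => padded p ℓ ∈ (gapNFA s M N).accepts) := by
  have hcount : countSat SDB (fun s => OccursWithGap p s M N) =
      countSat SDB (fun s => padded p ℓ ∈ (gapNFA s M N).accepts) := by
    apply List.countP_congr
    intro s hs
    simp only [decide_eq_true_eq]
    exact (padded_mem_accepts_iff p s M N ℓ (hℓ s hs) hp).symm
  rw [hcount]
end
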